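/- Assume additionally μ(x) > 0 for all x > 0, and for each λ > 0 let y*_λ denote the unique root of the function G_λ(x) = L_λ(x)/φ_λ'(x) + H(0,x)/(S'(x) m(0,x)). Then the map λ ↦ y*_λ is nondecreasing: if 0 < λ < λ̂ then y*_λ ≤ y*_λ̂. -/

import Mathlib

open MeasureTheory Filter

/-- The integral of a function that is positive on a set of positive measure is positive. -/
lemma setIntegral_pos_of_forall_pos {f : ℝ → ℝ} {s : Set ℝ} (hs : MeasurableSet s)
    (hv : 0 < volume s) (hi : IntegrableOn f s) (hf : ∀ x ∈ s, 0 < f x) :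
    0 < ∫ x in s, f x := by
  rw [setIntegral_pos_iff_support_of_nonneg_ae _ hi]
  · have : s ⊆ Function.support f ∩ s := fun x hx => ⟨(hf x hx).ne', hx⟩
    exact hv.trans_le (measure_mono this)
  · exact (ae_restrict_iff' hs).2 (Eventually.of_forall fun x hx => (hf x hx).le)

lemma intervalIntegrable_of_continuousOn_Ioi {f : ℝ → ℝ} (hf : ContinuousOn f (Set.Ioi 0))
    {a b : ℝ} (ha : 0 < a) (hb : 0 < b) : IntervalIntegrable f volume a b :=
  (hf.mono fun _ hz => (lt_min ha hb).trans_le hz.1).intervalIntegrable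

lemma hasDerivAt_intervalIntegral_of_continuousOn_Ioi {f : ℝ → ℝ}
    (hf : ContinuousOn f (Set.Ioi 0)) {a x : ℝ} (hx : 0 < x)
    (hi : IntervalIntegrable f volume a x) :
    HasDerivAt (fun u => ∫ z in a..u, f z) (f x) x :=
  intervalIntegral.integral_hasDerivAt_right hi
    (hf.stronglyMeasurableAtFilter isOpen_Ioi x hx) (hf.continuousAt (Ioi_mem_nhds hx))

lemma hasDerivAt_integral_Ioc_zero {f : ℝ → ℝ} (hf : ContinuousOn f (Set.Ioi 0))
    {x : ℝ} (hx : 0 < x) (hi : IntegrableOn f (Set.Ioc 0 x)) :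
    HasDerivAt (fun u => ∫ z in Set.Ioc 0 u, f z) (f x) x := by
  refine (hasDerivAt_intervalIntegral_of_continuousOn_Ioi (a := 0) hf hx
    ((intervalIntegrable_iff_integrableOn_Ioc_of_le hx.le).2 hi)).congr_of_eventuallyEq ?_
  filter_upwards [Ioi_mem_nhds hx] with u hu
  rw [intervalIntegral.integral_of_le (le_of_lt hu)]

lemma hasDerivAt_integral_Ioi {f : ℝ → ℝ} (hf : ContinuousOn f (Set.Ioi 0))
    (hi : ∀ x > 0, IntegrableOn f (Set.Ioi x)) {x : ℝ} (hx : 0 < x) :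
    HasDerivAt (fun u => ∫ z in Set.Ioi u, f z) (-f x) x := by
  have h := (hasDerivAt_intervalIntegral_of_continuousOn_Ioi hf hx
    (intervalIntegrable_of_continuousOn_Ioi hf hx hx)).const_sub (∫ z in Set.Ioi x, f z)
  refine h.congr_of_eventuallyEq ?_
  filter_upwards [Ioi_mem_nhds hx] with u hu
  have := intervalIntegral.integral_Ioi_sub_Ioi' (hi x hx) (hi u hu)
  linarith

/-- If `g` changes sign at most once, from negative to nonnegative, and integrates to zero against
the weight `w`, then it has nonpositive integral against any weight `v` for which `v / w` is
decreasing. -/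
lemma setIntegral_mul_nonpos_of_antitone_ratio {y : ℝ} {g w v : ℝ → ℝ}
    (hw : ∀ z ≥ y, 0 < w z) (hv : ∀ z ≥ y, 0 < v z)
    (hr : AntitoneOn (fun z => v z / w z) (Set.Ici y))
    (hg : ∀ s t, y < s → s ≤ t → 0 ≤ g s → 0 ≤ g t)
    (hgw : IntegrableOn (fun z => g z * w z) (Set.Ioi y))
    (hgv : IntegrableOn (fun z => g z * v z) (Set.Ioi y))
    (h0 : ∫ z in Set.Ioi y, g z * w z = 0) :
    ∫ z in Set.Ioi y, g z * v z ≤ 0 := by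
  set S : Set ℝ := {z | y < z ∧ 0 ≤ g z} with hS
  rcases S.eq_empty_or_nonempty with hE | hne
  · refine setIntegral_nonpos measurableSet_Ioi fun z hz => ?_
    have : ¬ (0 ≤ g z) := fun h => (hE ▸ (show z ∈ S from ⟨hz, h⟩) : z ∈ (∅ : Set ℝ))
    exact mul_nonpos_of_nonpos_of_nonneg (not_le.1 this).le (hv z (le_of_lt hz)).le
  · have hbd : BddBelow S := ⟨y, fun z hz => hz.1.le⟩
    set z₀ := sInf S
    have hz₀ : y ≤ z₀ := le_csInf hne fun z hz => hz.1.le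
    have key : ∀ z ∈ Set.Ioi y, g z * v z ≤ v z₀ / w z₀ * (g z * w z) := by
      intro z hz
      have hz' : y ≤ z := le_of_lt hz
      have hvz : v z = v z / w z * w z := by field_simp [(hw z hz').ne']
      have hwz := hw z hz'
      rcases lt_trichotomy z z₀ with h | h | h
      · have hgz : g z < 0 := not_le.1 fun h' => (csInf_le hbd (show z ∈ S from ⟨hz, h'⟩)).not_gt h
        have hle : v z₀ / w z₀ ≤ v z / w z := hr hz' hz₀ h.le
        have := mul_le_mul_of_nonpos_left (mul_le_mul_of_nonneg_right hle hwz.le) hgz.le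
        rw [← hvz] at this
        linarith
      · rw [← h]
        have : v z / w z * (g z * w z) = g z * (v z / w z * w z) := by ring
        rw [this, ← hvz]
      · obtain ⟨s, hs, hsz⟩ := exists_lt_of_csInf_lt hne h
        have hgz : 0 ≤ g z := hg s z hs.1 hsz.le hs.2
        have hle : v z / w z ≤ v z₀ / w z₀ := hr hz₀ hz' h.le
        have := mul_le_mul_of_nonneg_left (mul_le_mul_of_nonneg_right hle hwz.le) hgz
        rw [← hvz] at this
        linarith
    calc ∫ z in Set.Ioi y, g z * v z
        ≤ ∫ z in Set.Ioi y, v z₀ / w z₀ * (g z * w z) :=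
          setIntegral_mono_on hgv (hgw.const_mul _) measurableSet_Ioi key
      _ = 0 := by rw [integral_const_mul, h0, mul_zero]

/-- A function that is continuous on `[a, b]`, vanishes at `a` with negative derivative there and is
nonnegative at `b > a` has a zero in `(a, b]`. -/
lemma exists_zero_of_hasDerivAt_neg {F : ℝ → ℝ} {a b d : ℝ} (hab : a < b)
    (hF : ContinuousOn F (Set.Icc a b)) (ha : F a = 0) (hd : HasDerivAt F d a) (hd0 : d < 0)
    (hb : 0 ≤ F b) : ∃ x ∈ Set.Ioc a b, F x = 0 := by
  have hneg : ∀ᶠ x in nhdsWithin a (Set.Ioi a), slope F a x < 0 :=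
    ((hasDerivAt_iff_tendsto_slope.1 hd).mono_left
      (nhdsWithin_mono a fun x hx => ne_of_gt hx)).eventually (gt_mem_nhds hd0)
  obtain ⟨x, hx, hxab⟩ := (hneg.and (Ioo_mem_nhdsGT hab)).exists
  have hFx : F x < 0 := by
    rw [slope_def_field, ha, sub_zero] at hx
    by_contra h
    exact hx.not_ge (div_nonneg (not_lt.1 h) (sub_pos.2 hxab.1).le)
  obtain ⟨z, hz, hz0⟩ := intermediate_value_Icc hxab.2.le
    (hF.mono (Set.Icc_subset_Icc_left hxab.1.le)) ⟨hFx.le, hb⟩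
  exact ⟨z, ⟨hxab.1.trans_le hz.1, hz.2⟩, hz0⟩

/-- Assume μ > 0 on (0,∞), and for each λ > 0 let y*_λ be the unique
    root of G_λ(x) = L_λ(x)/φ_λ'(x) + H(0,x)/(S'(x) m(0,x)). Then λ ↦ y*_λ is
    nondecreasing. -/
theorem stmt_16
    (μ σ pf : ℝ → ℝ) (c : ℝ) (hc : 0 < c)
    (hμc : ContinuousOn μ (Set.Ioi 0)) (hσc : ContinuousOn σ (Set.Ioi 0))
    (hσ : ∀ x > 0, 0 < σ x)
    (hμpos : ∀ x > 0, 0 < μ x)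
    (S' m' : ℝ → ℝ)
    (hS'def : ∀ x > 0, S' x = Real.exp (-(∫ z in c..x, 2 * μ z / σ z ^ 2)))
    (hm'def : ∀ x > 0, m' x = 2 / (σ x ^ 2 * S' x))
    (m0 : ℝ → ℝ) (hm0def : ∀ x > 0, m0 x = ∫ z in Set.Ioc 0 x, m' z)
    (φ φ' φ'' : ℝ → ℝ → ℝ)
    (hφd : ∀ lam > 0, ∀ x > 0, HasDerivAt (φ lam) (φ' lam x) x)
    (hφd2 : ∀ lam > 0, ∀ x > 0, HasDerivAt (φ' lam) (φ'' lam x) x)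
    (hφ''c : ∀ lam > 0, ContinuousOn (φ'' lam) (Set.Ioi 0))
    (hφpos : ∀ lam > 0, ∀ x > 0, 0 < φ lam x)
    (hφanti : ∀ lam > 0, StrictAntiOn (φ lam) (Set.Ioi 0))
    (hode : ∀ lam > 0, ∀ x > 0,
      μ x * φ' lam x + σ x ^ 2 / 2 * φ'' lam x = lam * φ lam x)
    (hφ0 : ∀ lam > 0, Tendsto (φ lam) (nhdsWithin 0 (Set.Ioi 0)) atTop)
    (hφS0 : ∀ lam > 0,
      Tendsto (fun x => φ' lam x / S' x) (nhdsWithin 0 (Set.Ioi 0)) atBot)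
    (hφtop : ∀ lam > 0, Tendsto (φ lam) atTop (nhds 0))
    (hφStop : ∀ lam > 0, Tendsto (fun x => φ' lam x / S' x) atTop (nhds 0))
    (hpfc : ContinuousOn pf (Set.Ioi 0)) (hpfnn : ∀ x > 0, 0 ≤ pf x)
    (γ : ℝ) (hγ : 0 < γ)
    (pmu : ℝ → ℝ) (hpmudef : ∀ x > 0, pmu x = pf x + γ * μ x)
    (L : ℝ → ℝ → ℝ)
    (hLdef : ∀ lam > 0, ∀ x > 0,
      L lam x = lam * (∫ z in Set.Ioi x, pmu z * φ lam z * m' z)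
        + φ' lam x / S' x * pmu x)
    (H : ℝ → ℝ)
    (hHdef : ∀ x > 0, H x = (∫ z in Set.Ioc 0 x, pmu z * m' z) - pmu x * m0 x)
    (xstar : ℝ) (hxstar : 0 < xstar)
    (hdec : StrictAntiOn pmu (Set.Ioo 0 xstar))
    (hinc : StrictMonoOn pmu (Set.Ici xstar))
    (hlimpos : ∃ ε > 0, ∀ᶠ x in atTop, ε ≤ pmu x)
    (hmi : ∀ y > 0, IntegrableOn m' (Set.Ioc 0 y))
    (hpmi : ∀ y > 0, IntegrableOn (fun z => pmu z * m' z) (Set.Ioc 0 y))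
    (hφi : ∀ lam > 0, ∀ x > 0, IntegrableOn (fun z => φ lam z * m' z) (Set.Ioi x))
    (hpφi : ∀ lam > 0, ∀ x > 0,
      IntegrableOn (fun z => pmu z * φ lam z * m' z) (Set.Ioi x))
    (hS0 : Tendsto S' (nhdsWithin 0 (Set.Ioi 0)) atTop)
    (y : ℝ → ℝ)
    (hy : ∀ lam > 0, 0 < y lam ∧
      L lam (y lam) / φ' lam (y lam) + H (y lam) / (S' (y lam) * m0 (y lam)) = 0 ∧
      ∀ x > 0, L lam x / φ' lam x + H x / (S' x * m0 x) = 0 → x = y lam) :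
    ∀ lam lamh : ℝ, 0 < lam → lam < lamh → y lam ≤ y lamh := by
  intro lam lamh hlam hlt
  have hlamh : 0 < lamh := hlam.trans hlt
  have hS'pos : ∀ x > 0, 0 < S' x := fun x hx => by rw [hS'def x hx]; exact Real.exp_pos _
  have hm'pos : ∀ x > 0, 0 < m' x := fun x hx => by
    rw [hm'def x hx]
    exact div_pos two_pos (mul_pos (pow_pos (hσ x hx) 2) (hS'pos x hx))
  have hqc : ContinuousOn (fun z => 2 * μ z / σ z ^ 2) (Set.Ioi 0) :=
    (continuousOn_const.mul hμc).div (hσc.pow 2) fun x hx => (pow_pos (hσ x hx) 2).ne'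
  have hS'd : ∀ x > 0, HasDerivAt S' (S' x * -(2 * μ x / σ x ^ 2)) x := by
    intro x hx
    have h := (hasDerivAt_intervalIntegral_of_continuousOn_Ioi hqc hx
      (intervalIntegrable_of_continuousOn_Ioi hqc hc hx)).neg.exp
    have h' := h.congr_of_eventuallyEq (f₁ := S') (by
      filter_upwards [Ioi_mem_nhds hx] with u hu
      exact hS'def u hu)
    simp only [Pi.neg_apply] at h'
    rwa [← hS'def x hx] at h'
  have hS'c : ContinuousOn S' (Set.Ioi 0) := fun x hx =>
    (hS'd x hx).continuousAt.continuousWithinAt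
  have hm'c : ContinuousOn m' (Set.Ioi 0) :=
    (continuousOn_const.div ((hσc.pow 2).mul hS'c) fun x hx =>
      (mul_pos (pow_pos (hσ x hx) 2) (hS'pos x hx)).ne').congr fun x hx => hm'def x hx
  have hpc : ContinuousOn pmu (Set.Ioi 0) :=
    (hpfc.add (continuousOn_const.mul hμc)).congr fun x hx => hpmudef x hx
  have hφc : ∀ l > 0, ContinuousOn (φ l) (Set.Ioi 0) := fun l hl x hx =>
    (hφd l hl x hx).continuousAt.continuousWithinAt
  -- the derivative of `φ'` with respect to scale
  have hφSd : ∀ l > 0, ∀ x > 0,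
      HasDerivAt (fun u => φ' l u / S' u) (l * (φ l x * m' x)) x := by
    intro l hl x hx
    have h := (hφd2 l hl x hx).div (hS'd x hx) (hS'pos x hx).ne'
    have hs := (hS'pos x hx).ne'
    have hσ' := (hσ x hx).ne'
    have e : l * (φ l x * m' x) =
        (φ'' l x * S' x - φ' l x * (S' x * -(2 * μ x / σ x ^ 2))) / S' x ^ 2 := by
      rw [← mul_assoc, ← hode l hl x hx, hm'def x hx]
      field_simp
      ring
    rw [e]
    exact h
  set Q : ℝ → ℝ → ℝ := fun l x => ∫ z in Set.Ioi x, φ l z * m' z with hQ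
  set P : ℝ → ℝ → ℝ := fun l x => ∫ z in Set.Ioi x, pmu z * φ l z * m' z with hP
  set M : ℝ → ℝ := fun x => ∫ z in Set.Ioc 0 x, pmu z * m' z with hM
  have hwpos : ∀ l > 0, ∀ x > 0, 0 < φ l x * m' x := fun l hl x hx =>
    mul_pos (hφpos l hl x hx) (hm'pos x hx)
  have hQpos : ∀ l > 0, ∀ x > 0, 0 < Q l x := fun l hl x hx =>
    setIntegral_pos_of_forall_pos measurableSet_Ioi (by simp) (hφi l hl x hx)
      fun z hz => hwpos l hl z (hx.trans hz)
  have hm0pos : ∀ x > 0, 0 < m0 x := fun x hx => by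
    rw [hm0def x hx]
    exact setIntegral_pos_of_forall_pos measurableSet_Ioc (by simpa using hx) (hmi x hx)
      fun z hz => hm'pos z hz.1
  have hφ'eq : ∀ l > 0, ∀ x > 0, φ' l x = -(l * Q l x * S' x) := by
    intro l hl x hx
    have h := integral_Ioi_of_hasDerivAt_of_tendsto'
      (fun z hz => hφSd l hl z (hx.trans_le hz)) ((hφi l hl x hx).const_mul l) (hφStop l hl)
    rw [integral_const_mul] at h
    have hs := (hS'pos x hx).ne'
    have h2 : φ' l x / S' x = -(l * Q l x) := by simp only [hQ]; linarith
    rw [div_eq_iff hs] at h2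
    rw [h2]; ring
  set F : ℝ → ℝ → ℝ := fun l x => M x * Q l x - P l x * m0 x with hF
  have hG : ∀ l > 0, ∀ x > 0,
      L l x / φ' l x + H x / (S' x * m0 x) = F l x / (m0 x * Q l x * S' x) := by
    intro l hl x hx
    have hs := (hS'pos x hx).ne'
    have hq := (hQpos l hl x hx).ne'
    have hm := (hm0pos x hx).ne'
    have hl' := hl.ne'
    have e1 : L l x = l * P l x + φ' l x / S' x * pmu x := hLdef l hl x hx
    have e2 : H x = M x - pmu x * m0 x := hHdef x hx
    have e3 : F l x = M x * Q l x - P l x * m0 x := rfl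
    rw [e1, e2, e3, hφ'eq l hl x hx]
    clear_value Q P M
    field_simp
    ring
  have hG0 : ∀ l > 0, ∀ x > 0,
      (L l x / φ' l x + H x / (S' x * m0 x) = 0 ↔ F l x = 0) := by
    intro l hl x hx
    rw [hG l hl x hx, div_eq_zero_iff, or_iff_left]
    exact (mul_pos (mul_pos (hm0pos x hx) (hQpos l hl x hx)) (hS'pos x hx)).ne'
  have hFd : ∀ l > 0, ∀ x > 0, HasDerivAt (F l)
      (pmu x * m' x * Q l x + M x * -(φ l x * m' x)
        - (-(pmu x * φ l x * m' x) * m0 x + P l x * m' x)) x := by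
    intro l hl x hx
    have d1 : HasDerivAt M (pmu x * m' x) x :=
      hasDerivAt_integral_Ioc_zero (hpc.mul hm'c) hx (hpmi x hx)
    have d2 : HasDerivAt (Q l) (-(φ l x * m' x)) x :=
      hasDerivAt_integral_Ioi ((hφc l hl).mul hm'c) (hφi l hl) hx
    have d3 : HasDerivAt (P l) (-(pmu x * φ l x * m' x)) x :=
      hasDerivAt_integral_Ioi ((hpc.mul (hφc l hl)).mul hm'c) (hpφi l hl) hx
    have d4 : HasDerivAt m0 (m' x) x :=
      (hasDerivAt_integral_Ioc_zero hm'c hx (hmi x hx)).congr_of_eventuallyEq (by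
        filter_upwards [Ioi_mem_nhds hx] with u hu
        exact hm0def u hu)
    exact (d1.mul d2).sub (d3.mul d4)
  -- at a zero of `F`, the common average exceeds the current value of `pmu`
  have hroot : ∀ l > 0, ∀ x > 0, F l x = 0 → pmu x * Q l x < P l x ∧ pmu x * m0 x < M x := by
    intro l hl x hx h
    have hq := hQpos l hl x hx
    have hm := hm0pos x hx
    have h' : M x * Q l x = P l x * m0 x := sub_eq_zero.1 h
    rcases lt_or_ge x xstar with hxs | hxs
    · have hMlt : pmu x * m0 x < M x := by
        have i1 : IntegrableOn (fun z => pmu z * m' z - pmu x * m' z) (Set.Ioc 0 x) :=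
          (hpmi x hx).sub ((hmi x hx).const_mul _)
        have : 0 < ∫ z in Set.Ioo 0 x, (pmu z * m' z - pmu x * m' z) := by
          refine setIntegral_pos_of_forall_pos measurableSet_Ioo (by simpa using hx)
            (i1.mono_set Set.Ioo_subset_Ioc_self) fun z hz => ?_
          rw [← sub_mul]
          exact mul_pos (sub_pos.2 (hdec ⟨hz.1, hz.2.trans hxs⟩ ⟨hx, hxs⟩ hz.2))
            (hm'pos z hz.1)
        rw [← integral_Ioc_eq_integral_Ioo,
          integral_sub (hpmi x hx) ((hmi x hx).const_mul _), integral_const_mul,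
          ← hm0def x hx] at this
        exact sub_pos.1 this
      refine ⟨?_, hMlt⟩
      have := mul_lt_mul_of_pos_right hMlt hq
      rw [h'] at this
      exact lt_of_mul_lt_mul_right (by linarith : pmu x * Q l x * m0 x < P l x * m0 x) hm.le
    · have hPlt : pmu x * Q l x < P l x := by
        have i2 : IntegrableOn (fun z => pmu x * (φ l z * m' z)) (Set.Ioi x) :=
          (hφi l hl x hx).const_mul _
        have : 0 < ∫ z in Set.Ioi x, (pmu z * φ l z * m' z - pmu x * (φ l z * m' z)) := by
          refine setIntegral_pos_of_forall_pos measurableSet_Ioi (by simp)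
            ((hpφi l hl x hx).sub i2) fun z hz => ?_
          rw [mul_assoc, ← sub_mul]
          exact mul_pos (sub_pos.2 (hinc hxs (hxs.trans (le_of_lt hz)) hz))
            (hwpos l hl z (hx.trans hz))
        rw [integral_sub (hpφi l hl x hx) i2, integral_const_mul] at this
        exact sub_pos.1 this
      refine ⟨hPlt, ?_⟩
      have := mul_lt_mul_of_pos_right hPlt hm
      rw [← h'] at this
      exact lt_of_mul_lt_mul_right (by linarith : pmu x * m0 x * Q l x < M x * Q l x) hq.le
  -- the ratio of the decreasing solutions is decreasing
  have hW : ∀ x > 0, φ' lamh x * φ lam x - φ lamh x * φ' lam x ≤ 0 := by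
    intro x hx
    set W : ℝ → ℝ := fun u => φ' lamh u / S' u * φ lam u - φ lamh u * (φ' lam u / S' u) with hWdef
    have hWd : ∀ u > 0, HasDerivAt W ((lamh - lam) * (φ lamh u * φ lam u * m' u)) u := by
      intro u hu
      have h := ((hφSd lamh hlamh u hu).mul (hφd lam hlam u hu)).sub
        ((hφd lamh hlamh u hu).mul (hφSd lam hlam u hu))
      have e : (lamh - lam) * (φ lamh u * φ lam u * m' u) =
          lamh * (φ lamh u * m' u) * φ lam u + φ' lamh u / S' u * φ' lam u
            - (φ' lamh u * (φ' lam u / S' u) + φ lamh u * (lam * (φ lam u * m' u))) := by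
        ring
      rw [e]
      exact h
    have hWmono : MonotoneOn W (Set.Ioi 0) := by
      refine monotoneOn_of_hasDerivWithinAt_nonneg (convex_Ioi 0)
        (fun u hu => (hWd u hu).continuousAt.continuousWithinAt)
        (fun u hu => (hWd u (interior_subset hu)).hasDerivWithinAt) fun u hu => ?_
      have hu' : 0 < u := interior_subset hu
      exact mul_nonneg (sub_pos.2 hlt).le (mul_pos (mul_pos (hφpos _ hlamh u hu')
        (hφpos _ hlam u hu')) (hm'pos u hu')).le
    have hWlim : Tendsto W atTop (nhds 0) := by
      simpa using ((hφStop lamh hlamh).mul (hφtop lam hlam)).sub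
        ((hφtop lamh hlamh).mul (hφStop lam hlam))
    have hWx : W x ≤ 0 := ge_of_tendsto hWlim (by
      filter_upwards [eventually_ge_atTop x] with u hu
      exact hWmono hx (hx.trans_le hu) hu)
    have hs := hS'pos x hx
    have e : W x = (φ' lamh x * φ lam x - φ lamh x * φ' lam x) / S' x := by
      simp only [hWdef]; ring
    rw [e, div_le_iff₀ hs, zero_mul] at hWx
    exact hWx
  have hratio : AntitoneOn (fun z => φ lamh z / φ lam z) (Set.Ioi 0) := by
    have hd : ∀ u > 0, HasDerivAt (fun z => φ lamh z / φ lam z)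
        ((φ' lamh u * φ lam u - φ lamh u * φ' lam u) / φ lam u ^ 2) u := fun u hu =>
      (hφd lamh hlamh u hu).div (hφd lam hlam u hu) (hφpos lam hlam u hu).ne'
    exact antitoneOn_of_hasDerivWithinAt_nonpos (convex_Ioi 0)
      (fun u hu => (hd u hu).continuousAt.continuousWithinAt)
      (fun u hu => (hd u (interior_subset hu)).hasDerivWithinAt) fun u hu =>
        div_nonpos_of_nonpos_of_nonneg (hW u (interior_subset hu)) (sq_nonneg _)
  obtain ⟨hy0, hyG, -⟩ := hy lam hlam
  obtain ⟨hyh0, hyhG, hyhu⟩ := hy lamh hlamh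
  have hFy : F lam (y lam) = 0 := (hG0 lam hlam _ hy0).1 hyG
  have hFyh : F lamh (y lamh) = 0 := (hG0 lamh hlamh _ hyh0).1 hyhG
  set a := P lam (y lam) / Q lam (y lam) with ha
  have hq := hQpos lam hlam _ hy0
  have hPa : P lam (y lam) = a * Q lam (y lam) := (div_mul_cancel₀ _ hq.ne').symm
  have hMa : M (y lam) = a * m0 (y lam) := by
    have h' : M (y lam) * Q lam (y lam) = P lam (y lam) * m0 (y lam) := sub_eq_zero.1 hFy
    rw [hPa] at h'
    exact mul_right_cancel₀ hq.ne' (by linarith)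
  have hpa : pmu (y lam) < a := (lt_div_iff₀ hq).2 (hroot lam hlam _ hy0 hFy).1
  have hint : ∀ l > 0, IntegrableOn (fun z => (pmu z - a) * (φ l z * m' z)) (Set.Ioi (y lam)) ∧
      ∫ z in Set.Ioi (y lam), (pmu z - a) * (φ l z * m' z) =
        P l (y lam) - a * Q l (y lam) := by
    intro l hl
    have e : (fun z => (pmu z - a) * (φ l z * m' z)) =
        fun z => pmu z * φ l z * m' z - a * (φ l z * m' z) := by
      ext z; ring
    have i2 : IntegrableOn (fun z => a * (φ l z * m' z)) (Set.Ioi (y lam)) :=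
      (hφi l hl _ hy0).const_mul _
    rw [e]
    refine ⟨(hpφi l hl _ hy0).sub i2, ?_⟩
    rw [integral_sub (hpφi l hl _ hy0) i2, integral_const_mul]
  have htilt : P lamh (y lam) ≤ a * Q lamh (y lam) := by
    rw [← sub_nonpos, ← (hint lamh hlamh).2]
    refine setIntegral_mul_nonpos_of_antitone_ratio (w := fun z => φ lam z * m' z)
      (fun z hz => hwpos lam hlam z (hy0.trans_le hz))
      (fun z hz => hwpos lamh hlamh z (hy0.trans_le hz)) ?_ ?_
      (hint lam hlam).1 (hint lamh hlamh).1 ?_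
    · refine (hratio.mono fun z hz => hy0.trans_le hz).congr fun z hz => ?_
      exact (mul_div_mul_right _ _ (hm'pos z (hy0.trans_le hz)).ne').symm
    · intro s t hs hst h
      have hxs : xstar ≤ s := by
        by_contra! hlt'
        have := hdec ⟨hy0, hs.trans hlt'⟩ ⟨hy0.trans hs, hlt'⟩ hs
        linarith
      have := hinc.monotoneOn hxs (hxs.trans hst) hst
      linarith
    · rw [(hint lam hlam).2, hPa, sub_self]
  have hFnonneg : 0 ≤ F lamh (y lam) := by
    have := mul_le_mul_of_nonneg_right htilt (hm0pos _ hy0).le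
    simp only [hF, hMa]
    linarith
  by_contra! hcon
  obtain ⟨x, hx, hx0⟩ := exists_zero_of_hasDerivAt_neg hcon
    (fun u hu => (hFd lamh hlamh u (hyh0.trans_le hu.1)).continuousAt.continuousWithinAt)
    hFyh (hFd lamh hlamh _ hyh0) (by
      obtain ⟨h1, h2⟩ := hroot lamh hlamh _ hyh0 hFyh
      have b1 := mul_pos (sub_pos.2 h1) (hm'pos _ hyh0)
      have b2 := mul_pos (sub_pos.2 h2) (hwpos lamh hlamh _ hyh0)
      linarith) hFnonneg
  have hxpos := hyh0.trans hx.1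
  exact hx.1.ne' (hyhu x hxpos ((hG0 lamh hlamh x hxpos).2 hx0))
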